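/- Let S be a Cohen–Macaulay Noetherian ring and let I be an unmixed ideal of S of height c that is generically a complete intersection. Then I^(2) = I^2 : F_c(I), where F_c(I) is the c-th Fitting ideal of I regarded as an S-module. -/

import Mathlib

open Ideal Filter

universe u

/-- The `m`-th symbolic power of an ideal `I`: the intersection, over all associated primes `p`
of `S ⧸ I`, of the contractions of `I ^ m` extended to the localization at `p`. -/
noncomputable def symbolicPower {S : Type*} [CommRing S] (I : Ideal S) (m : ℕ) : Ideal S :=
  ⨅ p : associatedPrimes S (S ⧸ I),
    letI : p.1.IsPrime := p.2.isPrime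
    ((I ^ m).map (algebraMap S (Localization.AtPrime p.1))).comap
      (algebraMap S (Localization.AtPrime p.1))

/-- The height of an ideal: the infimum of the heights of the primes containing it. -/
noncomputable def idealHeight {S : Type*} [CommRing S] (I : Ideal S) : ℕ∞ :=
  ⨅ (p : PrimeSpectrum S) (_ : I ≤ p.asIdeal), Order.height p

/-- An ideal is unmixed of height `c` if it has height `c` and every associated prime of `S ⧸ I`
has height `c`. -/
def IsUnmixedOfHeight {S : Type*} [CommRing S] (I : Ideal S) (c : ℕ) : Prop :=
  idealHeight I = (c : ℕ∞) ∧ ∀ p ∈ associatedPrimes S (S ⧸ I), idealHeight p = (c : ℕ∞)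

/-- An ideal `I` is generically a complete intersection if, for every associated prime `p` of
`S ⧸ I`, the extension of `I` to the localization at `p` is generated by a regular sequence. -/
def IsGenericallyCI {S : Type*} [CommRing S] (I : Ideal S) : Prop :=
  ∀ p : associatedPrimes S (S ⧸ I),
    letI : p.1.IsPrime := p.2.isPrime
    ∃ rs : List (Localization.AtPrime p.1),
      RingTheory.Sequence.IsRegular (Localization.AtPrime p.1) rs ∧
      Ideal.ofList rs = I.map (algebraMap S (Localization.AtPrime p.1))

/-- The depth of a local ring: the supremum of lengths of regular sequences contained in the
maximal ideal. -/
noncomputable def localDepth (R : Type*) [CommRing R] [IsLocalRing R] : ℕ∞ :=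
  ⨆ rs : {rs : List R // (∀ x ∈ rs, x ∈ IsLocalRing.maximalIdeal R) ∧
      RingTheory.Sequence.IsRegular R rs}, (rs.1.length : ℕ∞)

/-- A ring is Cohen-Macaulay if the localization at every prime ideal has depth equal to its
Krull dimension. -/
def IsCohenMacaulayRing (S : Type*) [CommRing S] : Prop :=
  ∀ (p : Ideal S) (_hp : p.IsPrime),
    (localDepth (Localization.AtPrime p) : WithBot ℕ∞) = ringKrullDim (Localization.AtPrime p)

/-- The `j`-th Fitting ideal of a module `M`: the ideal generated by the `(n - j)`-minors of a
presentation matrix coming from any generating family of size `n`. -/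
noncomputable def fittingIdeal (S : Type*) [CommRing S] (M : Type*) [AddCommGroup M]
    [Module S M] (j : ℕ) : Ideal S :=
  ⨆ (n : ℕ) (g : Fin n → M) (_ : Submodule.span S (Set.range g) = ⊤),
    Ideal.span { d : S | ∃ (r : Fin (n - j) → Fin n → S) (ι : Fin (n - j) → Fin n),
      (∀ k, ∑ i, r k i • g i = 0) ∧ d = Matrix.det (Matrix.of fun k l => r l (ι k)) }

namespace Matrix

/-- The determinant of a square matrix factoring through a smaller free module vanishes. -/
theorem det_mul_eq_zero_of_card_lt {R α β : Type*} [CommRing R] [Fintype α] [DecidableEq α]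
    [Fintype β] (X : Matrix α β R) (Y : Matrix β α R)
    (h : Fintype.card β < Fintype.card α) : (X * Y).det = 0 := by
  let k := Fintype.card α - Fintype.card β
  have hk : Fintype.card α = Fintype.card (β ⊕ Fin k) := by
    simp only [Fintype.card_sum, Fintype.card_fin, k]
    omega
  let e : α ≃ β ⊕ Fin k := Fintype.equivOfCardEq hk
  have hXY : X * Y = (fromCols X (0 : Matrix α (Fin k) R)).submatrix id e *
      (fromRows Y (0 : Matrix (Fin k) α R)).submatrix e id := by
    rw [submatrix_mul_equiv, fromCols_mul_fromRows]
    simp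
  rw [hXY, det_mul, det_eq_zero_of_column_eq_zero (e.symm (Sum.inr ⟨0, by omega⟩))
    (fun i => by simp), zero_mul]

/-- If the columns of `P` are part of a split surjection of rank `m` and the rows of `r` are
killed by it, then all minors of `r` of size larger than `n - m` vanish. -/
theorem det_submatrix_eq_zero_of_mul_eq_zero {R : Type*} [CommRing R] {N n m : ℕ}
    (r : Matrix (Fin N) (Fin n) R) (P : Matrix (Fin n) (Fin m) R) (Q : Matrix (Fin m) (Fin n) R)
    (hQP : Q * P = 1) (hrP : r * P = 0) (h : n < N + m) (ι : Fin N → Fin n) :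
    (r.submatrix id ι).det = 0 := by
  let E : Matrix (Fin n) (Fin N) R := (1 : Matrix (Fin n) (Fin n) R).submatrix id ι
  have hE : r * E = r.submatrix id ι := by
    ext i j
    simp [E, mul_apply, one_apply]
  have hdet := det_mul_eq_zero_of_card_lt (fromRows r Q) (fromCols E P) (by simpa using h)
  rwa [fromRows_mul_fromCols, hrP, hQP, hE, det_fromBlocks_zero₁₂, det_one, mul_one] at hdet

end Matrix

/-- The coefficients of a linear relation among the elements of a weakly regular sequence lie in
the ideal the sequence generates. -/
theorem mem_span_range_of_sum_mul_eq_zero {A : Type*} [CommRing A] {m : ℕ} (y : Fin m → A)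
    (hy : ∀ i a, a * y i ∈ Ideal.span (y '' Set.Iio i) → a ∈ Ideal.span (y '' Set.Iio i))
    (a : Fin m → A) (ha : ∑ i, a i * y i = 0) (i : Fin m) :
    a i ∈ Ideal.span (Set.range y) := by
  induction m with
  | zero => exact i.elim0
  | succ m ih =>
    have himage (j : Fin m) :
        y '' Set.Iio j.castSucc = (fun l : Fin m => y l.castSucc) '' Set.Iio j := by
      rw [← Fin.image_castSucc_Iio, Set.image_image]
    have hlast : y '' Set.Iio (Fin.last m) = Set.range fun l : Fin m => y l.castSucc := by
      ext z
      simp only [Set.mem_image, Set.mem_Iio, Set.mem_range]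
      constructor
      · rintro ⟨l, hl, rfl⟩
        exact ⟨l.castPred hl.ne, by simp⟩
      · rintro ⟨l, rfl⟩
        exact ⟨_, l.castSucc_lt_last, rfl⟩
    have hle : Ideal.span (Set.range fun l : Fin m => y l.castSucc) ≤ Ideal.span (Set.range y) :=
      Ideal.span_mono (by rintro _ ⟨l, rfl⟩; exact ⟨_, rfl⟩)
    rw [Fin.sum_univ_castSucc] at ha
    have hmem : a (Fin.last m) ∈ Ideal.span (Set.range fun l : Fin m => y l.castSucc) := by
      rw [← hlast]
      apply hy
      rw [hlast, eq_neg_of_add_eq_zero_right ha]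
      exact neg_mem (sum_mem fun j _ => Ideal.mul_mem_left _ _ (Ideal.subset_span ⟨j, rfl⟩))
    obtain ⟨c, hc⟩ := Ideal.mem_span_range_iff_exists_fun.1 hmem
    induction i using Fin.lastCases with
    | last => exact hle hmem
    | cast i =>
      have hrec := ih (fun l => y l.castSucc) (fun j b hb => by
          have := hy j.castSucc b
          rw [himage] at this
          exact this hb) (fun j => a j.castSucc + c j * y (Fin.last m)) (by
          rw [← ha, ← hc, Finset.sum_mul, ← Finset.sum_add_distrib]
          exact Finset.sum_congr rfl fun j _ => by ring) i
      have hyl : c i * y (Fin.last m) ∈ Ideal.span (Set.range y) :=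
        Ideal.mul_mem_left _ _ (Ideal.subset_span ⟨_, rfl⟩)
      simpa using sub_mem (hle hrec) hyl

theorem Ideal.span_range_get {A : Type*} [CommRing A] (rs : List A) :
    Ideal.span (Set.range rs.get) = Ideal.ofList rs := by
  rw [Set.range_list_get]

theorem RingTheory.Sequence.IsWeaklyRegular.mem_ofList_of_sum_mul_eq_zero {A : Type*} [CommRing A]
    {rs : List A} (h : RingTheory.Sequence.IsWeaklyRegular A rs) (a : Fin rs.length → A)
    (ha : ∑ i, a i * rs.get i = 0) (i : Fin rs.length) : a i ∈ Ideal.ofList rs := by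
  rw [← Ideal.span_range_get]
  refine mem_span_range_of_sum_mul_eq_zero rs.get (fun i b hb => ?_) a ha i
  have hset : rs.get '' Set.Iio i = {r | r ∈ rs.take i} := by
    ext r
    simp only [Set.mem_image, Set.mem_Iio, Set.mem_ofPred_eq, List.mem_take_iff_getElem]
    constructor
    · rintro ⟨j, hj, rfl⟩
      exact ⟨j, by omega, rfl⟩
    · rintro ⟨j, hj, rfl⟩
      exact ⟨⟨j, by omega⟩, by simp [Fin.lt_def]; omega, rfl⟩
  have hreg := (isWeaklyRegular_iff_Fin A rs).1 h i
  rw [hset] at hb ⊢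
  rw [isSMulRegular_quotient_iff_mem_of_smul_mem] at hreg
  simpa [Ideal.ofList] using hreg b (by simpa [Ideal.ofList, mul_comm] using hb)

/-- Minors of the relations modulo `J ^ 2` of size larger than `n - m` lie in `J`, when `J` is
generated by `m` elements that are independent modulo `J`. -/
theorem Ideal.det_mem_of_sum_mul_mem_sq {A : Type*} [CommRing A] (J : Ideal A) {N n m : ℕ}
    (y : Fin m → A) (hyJ : Ideal.span (Set.range y) = J)
    (hy : ∀ a : Fin m → A, ∑ i, a i * y i = 0 → ∀ i, a i ∈ J)
    (g : Fin n → A) (hgJ : Ideal.span (Set.range g) = J) (h : n < N + m)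
    (r : Matrix (Fin N) (Fin n) A) (hr : ∀ k, ∑ i, r k i * g i ∈ J ^ 2) (ι : Fin N → Fin n) :
    (r.submatrix id ι).det ∈ J := by
  have hy2 (a : Fin m → A) (ha : ∑ i, a i * y i ∈ J ^ 2) (i : Fin m) : a i ∈ J := by
    rw [pow_two] at ha
    nth_rw 2 [← hyJ] at ha
    rw [← smul_eq_mul, Submodule.mem_ideal_smul_span_iff_exists_sum] at ha
    obtain ⟨b, hb, hsum⟩ := ha
    rw [Finsupp.sum_fintype _ _ (by simp)] at hsum
    have := hy (fun i => a i - b i) (by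
      simp only [sub_mul, Finset.sum_sub_distrib, ← hsum, smul_eq_mul, sub_self]) i
    simpa using add_mem this (hb i)
  have hg (i : Fin n) : ∃ c : Fin m → A, ∑ k, c k * y k = g i := by
    rw [← Ideal.mem_span_range_iff_exists_fun, hyJ, ← hgJ]
    exact Ideal.subset_span ⟨i, rfl⟩
  have hyg (k : Fin m) : ∃ c : Fin n → A, ∑ i, c i * g i = y k := by
    rw [← Ideal.mem_span_range_iff_exists_fun, hgJ, ← hyJ]
    exact Ideal.subset_span ⟨k, rfl⟩
  choose P hP using hg
  choose Q hQ using hyg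
  have hmul (c : Fin n → A) :
      ∑ k, (∑ i, c i * P i k) * y k = ∑ i, c i * g i := by
    simp only [← hP, Finset.sum_mul, Finset.mul_sum]
    rw [Finset.sum_comm]
    simp only [mul_assoc]
  let q := Ideal.Quotient.mk J
  rw [← Ideal.Quotient.eq_zero_iff_mem, RingHom.map_det]
  refine Matrix.det_submatrix_eq_zero_of_mul_eq_zero (r.map q) ((Matrix.of P).map q)
    ((Matrix.of Q).map q) ?_ ?_ h ι
  · rw [← Matrix.map_mul, ← Matrix.map_one q (map_zero q) (map_one q)]
    ext k l
    simp only [Matrix.map_apply]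
    refine Ideal.Quotient.eq.2 (hy (fun l => (Matrix.of Q * Matrix.of P) k l -
      (1 : Matrix (Fin m) (Fin m) A) k l) ?_ l)
    simp only [sub_mul, Finset.sum_sub_distrib, Matrix.mul_apply, Matrix.of_apply, hmul, hQ]
    simp [Matrix.one_apply]
  · rw [← Matrix.map_mul]
    ext k l
    refine Ideal.Quotient.eq_zero_iff_mem.2 (hy2 (fun l => (r * Matrix.of P) k l) ?_ l)
    simp only [Matrix.mul_apply, Matrix.of_apply, hmul]
    exact hr k

/-- Membership in an ideal of a Noetherian ring can be tested at its associated primes. -/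
theorem Ideal.mem_of_forall_associatedPrimes {S : Type*} [CommRing S] [IsNoetherianRing S]
    (I : Ideal S) (x : S) (h : ∀ p ∈ associatedPrimes S (S ⧸ I), ∃ s ∉ p, s * x ∈ I) : x ∈ I := by
  by_contra hx
  obtain ⟨p, hp, hle⟩ := exists_le_isAssociatedPrime_of_isNoetherianRing S
    (Ideal.Quotient.mk I x) (by rwa [Ne, Ideal.Quotient.eq_zero_iff_mem])
  obtain ⟨s, hs, hsx⟩ := h p hp
  refine hs (hle ?_)
  rw [Submodule.mem_colon_singleton, Submodule.mem_bot, Algebra.smul_def,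
    Ideal.Quotient.algebraMap_eq, ← map_mul]
  exact Ideal.Quotient.eq_zero_iff_mem.2 hsx

/-- Laplace expansion of the minors of `r` bordered by a row `t`, paired with `g`. -/
theorem sum_det_cons_mul {S : Type*} [CommRing S] {N n : ℕ} (g t : Fin n → S)
    (r : Fin N → Fin n → S) (hr : ∀ k, ∑ i, r k i * g i = 0) (ι : Fin N → Fin n) :
    ∑ j, ((Matrix.of (Fin.cons t r : Fin (N + 1) → Fin n → S)).submatrix id
      (Fin.cons j ι : Fin (N + 1) → Fin n)).det * g j =
      (∑ i, t i * g i) * (Matrix.of fun k l => r l (ι k)).det := by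
  rw [← Matrix.det_transpose (Matrix.of fun k l => r l (ι k))]
  simp only [Matrix.det_succ_column_zero, Finset.sum_mul]
  rw [Finset.sum_comm, Fin.sum_univ_succ, Finset.sum_eq_zero (s := Finset.univ (α := Fin N)),
    add_zero]
  · refine Finset.sum_congr rfl fun j _ => ?_
    have : ((Matrix.of (Fin.cons t r : Fin (N + 1) → Fin n → S)).submatrix id
        (Fin.cons j ι : Fin (N + 1) → Fin n)).submatrix (Fin.succAbove 0) Fin.succ =
        (Matrix.of fun k l => r l (ι k)).transpose := by
      ext k l
      simp
    rw [this]
    simp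
    ring
  · intro k _
    have hsub (j : Fin n) : ((Matrix.of (Fin.cons t r : Fin (N + 1) → Fin n → S)).submatrix id
        (Fin.cons j ι : Fin (N + 1) → Fin n)).submatrix k.succ.succAbove Fin.succ =
        (Matrix.of (Fin.cons t r : Fin (N + 1) → Fin n → S)).submatrix k.succ.succAbove ι := by
      ext
      simp
    simp only [hsub]
    rw [← mul_zero ((-1) ^ (k.succ : ℕ) *
      ((Matrix.of (Fin.cons t r : Fin (N + 1) → Fin n → S)).submatrix k.succ.succAbove ι).det),
      ← hr k, Finset.mul_sum]
    refine Finset.sum_congr rfl fun j _ => ?_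
    simp
    ring

theorem idealHeight_eq_height {S : Type*} [CommRing S] (p : Ideal S) [hp : p.IsPrime] :
    idealHeight p = p.height := by
  rw [show p.height = Order.height (⟨p, hp⟩ : PrimeSpectrum S) from
    PrimeSpectrum.height_eq_orderHeight ⟨p, hp⟩]
  exact le_antisymm (iInf₂_le (⟨p, hp⟩ : PrimeSpectrum S) le_rfl)
    (le_iInf₂ fun q hq => Order.height_mono (show (⟨p, hp⟩ : PrimeSpectrum S) ≤ q from hq))

theorem mem_symbolicPower_iff {S : Type*} [CommRing S] (I : Ideal S) (m : ℕ) (x : S) :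
    x ∈ symbolicPower I m ↔ ∀ p ∈ associatedPrimes S (S ⧸ I), ∃ s ∉ p, s * x ∈ I ^ m := by
  simp only [symbolicPower, Submodule.mem_iInf, Subtype.forall]
  refine forall₂_congr fun p hp => ?_
  have := hp.isPrime
  rw [Ideal.mem_comap, IsLocalization.algebraMap_mem_map_algebraMap_iff p.primeCompl]
  rfl

/-- If all primes over `I` have height at least `c` and `p` has height `c`, then a regular sequence
generating `I` at `p` has length `c`. -/
theorem length_eq_of_isRegular_of_ofList_eq_map {S : Type*} [CommRing S] [IsNoetherianRing S]
    {I : Ideal S} {c : ℕ} (hI : idealHeight I = c) (p : Ideal S) [p.IsPrime] (hp : p.height = c)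
    {rs : List (Localization.AtPrime p)}
    (hrs : RingTheory.Sequence.IsRegular (Localization.AtPrime p) rs)
    (hrsI : Ideal.ofList rs = I.map (algebraMap S (Localization.AtPrime p))) :
    rs.length = c := by
  have hne : Ideal.ofList rs ≠ ⊤ := fun h => hrs.top_ne_smul (by simp [h])
  apply le_antisymm
  · have hdim := ringKrullDim_add_length_eq_ringKrullDim_of_isRegular rs hrs
    rw [IsLocalization.AtPrime.ringKrullDim_eq_height p (Localization.AtPrime p), hp] at hdim
    have : Nontrivial (Localization.AtPrime p ⧸ Ideal.ofList rs) :=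
      Ideal.Quotient.nontrivial_iff.2 hne
    have h0 := ringKrullDim_nonneg_of_nontrivial (R := Localization.AtPrime p ⧸ Ideal.ofList rs)
    have hle : (rs.length : WithBot ℕ∞) ≤ ((c : ℕ∞) : WithBot ℕ∞) := by
      rw [← hdim]
      exact le_add_of_nonneg_left h0
    exact_mod_cast hle
  · have hc : (c : ℕ∞) ≤ (Ideal.ofList rs).height := by
      rw [Ideal.height_eq_inf_minimalPrimes]
      refine le_iInf₂ fun q hq => ?_
      have := hq.isPrime
      rw [← IsLocalization.height_under p.primeCompl q, ← hI]
      have hle : I ≤ q.under S := by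
        rw [Ideal.under_def, ← Ideal.map_le_iff_le_comap, ← hrsI]
        exact hq.1.2
      exact (iInf₂_le (⟨q.under S, inferInstance⟩ : PrimeSpectrum S) hle).trans_eq
        (PrimeSpectrum.height_eq_orderHeight _).symm
    have hle : (Ideal.ofList rs).height ≤ rs.length := by
      rw [← Ideal.span_range_get]
      rw [← Ideal.span_range_get] at hne
      refine (Ideal.height_le_spanFinrank _ hne).trans (Nat.cast_le.2 ?_)
      refine (Submodule.spanFinrank_span_le_ncard_of_finite (Set.finite_range rs.get)).trans ?_
      rw [← Set.image_univ]
      exact (Set.ncard_image_le Set.finite_univ).trans_eq (by simp)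
    exact_mod_cast hc.trans hle

theorem exists_generators_localization {S : Type*} [CommRing S] [IsNoetherianRing S]
    {I : Ideal S} {c : ℕ} (hunm : IsUnmixedOfHeight I c) (hgci : IsGenericallyCI I)
    (p : Ideal S) [p.IsPrime] (hp : p ∈ associatedPrimes S (S ⧸ I)) :
    ∃ y : Fin c → Localization.AtPrime p,
      Ideal.span (Set.range y) = I.map (algebraMap S (Localization.AtPrime p)) ∧
      ∀ a : Fin c → Localization.AtPrime p, ∑ i, a i * y i = 0 →
        ∀ i, a i ∈ I.map (algebraMap S (Localization.AtPrime p)) := by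
  obtain ⟨rs, hrs, hrsI⟩ := hgci ⟨p, hp⟩
  obtain rfl := length_eq_of_isRegular_of_ofList_eq_map hunm.1 p
    (by rw [← idealHeight_eq_height, hunm.2 p hp]) hrs hrsI
  refine ⟨rs.get, by rw [Ideal.span_range_get, hrsI], fun a ha i => ?_⟩
  rw [← hrsI]
  exact hrs.toIsWeaklyRegular.mem_ofList_of_sum_mul_eq_zero a ha i

theorem mul_det_mem_sq_of_mem_symbolicPower {S : Type*} [CommRing S] [IsNoetherianRing S]
    {I : Ideal S} {c : ℕ} (hunm : IsUnmixedOfHeight I c) (hgci : IsGenericallyCI I) {x : S}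
    (hx : x ∈ symbolicPower I 2) {n N : ℕ} (hN : n < N + 1 + c) (g : Fin n → S)
    (hg : Ideal.span (Set.range g) = I) (r : Fin N → Fin n → S)
    (hr : ∀ k, ∑ i, r k i * g i = 0) (ι : Fin N → Fin n) :
    x * (Matrix.of fun k l => r l (ι k)).det ∈ I ^ 2 := by
  rw [mem_symbolicPower_iff] at hx
  have hxI : x ∈ I := I.mem_of_forall_associatedPrimes x fun p hp =>
    (hx p hp).imp fun s hs => ⟨hs.1, Ideal.pow_le_self two_ne_zero hs.2⟩
  obtain ⟨t, rfl⟩ := Ideal.mem_span_range_iff_exists_fun.1 (hg ▸ hxI)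
  rw [← sum_det_cons_mul g t r hr ι, pow_two]
  refine sum_mem fun j _ => Ideal.mul_mem_mul ?_ (hg ▸ Ideal.subset_span ⟨j, rfl⟩)
  refine I.mem_of_forall_associatedPrimes _ fun p hp => ?_
  have := hp.isPrime
  let φ := algebraMap S (Localization.AtPrime p)
  obtain ⟨y, hyI, hy⟩ := exists_generators_localization hunm hgci p hp
  refine (IsLocalization.algebraMap_mem_map_algebraMap_iff p.primeCompl
    (Localization.AtPrime p) I _).1 ?_
  rw [RingHom.map_det]
  refine Ideal.det_mem_of_sum_mul_mem_sq (I.map φ) y hyI hy (fun i => φ (g i)) ?_ hN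
    ((Matrix.of (Fin.cons t r : Fin (N + 1) → Fin n → S)).map φ) (fun k => ?_) (Fin.cons j ι)
  · rw [← hg, Ideal.map_span, ← Set.range_comp]
    rfl
  · simp only [Matrix.map_apply, ← map_mul, ← map_sum, ← Ideal.map_pow]
    induction k using Fin.cases with
    | zero =>
      exact (IsLocalization.algebraMap_mem_map_algebraMap_iff p.primeCompl
        (Localization.AtPrime p) (I ^ 2) _).2 (hx p hp)
    | succ k =>
      simp [hr k]

/-- If `I` is generated by `c` elements at the prime `p`, then its `c`-th Fitting ideal is not
contained in `p`. -/
theorem exists_mem_fittingIdeal_notMem {S : Type*} [CommRing S] [IsNoetherianRing S] {I : Ideal S}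
    {c : ℕ} (p : Ideal S) [p.IsPrime] (y : Fin c → Localization.AtPrime p)
    (hy : Ideal.span (Set.range y) = I.map (algebraMap S (Localization.AtPrime p))) :
    ∃ s ∈ fittingIdeal S I c, s ∉ p := by
  let φ := algebraMap S (Localization.AtPrime p)
  have hlift (k : Fin c) : ∃ z : I × p.primeCompl, y k * φ z.2 = φ z.1 := by
    rw [← IsLocalization.mem_map_algebraMap_iff, ← hy]
    exact Ideal.subset_span ⟨k, rfl⟩
  choose z hz using hlift
  let f : Fin c → I := fun k => (z k).1
  have hf : I.map φ ≤ (Ideal.span (Set.range fun k => (f k : S))).map φ := by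
    rw [← hy, Ideal.span_le]
    rintro _ ⟨k, rfl⟩
    rw [SetLike.mem_coe, ← Ideal.mul_unit_mem_iff_mem _
      (IsLocalization.map_units (Localization.AtPrime p) (z k).2), hz]
    exact Ideal.mem_map_of_mem _ (Ideal.subset_span ⟨k, rfl⟩)
  obtain ⟨n, g, hg⟩ := Submodule.fg_iff_exists_fin_generating_family.1
    (Module.finite_def.1 (inferInstance : Module.Finite S I))
  have hrel (k : Fin n) : ∃ s ∈ p.primeCompl,
      s * (g k : S) ∈ Ideal.span (Set.range fun k => (f k : S)) :=
    (IsLocalization.algebraMap_mem_map_algebraMap_iff p.primeCompl (Localization.AtPrime p) _ _).1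
      (hf (Ideal.mem_map_of_mem _ (g k).2))
  choose s hsp hs using hrel
  have hcoeff (k : Fin n) := Ideal.mem_span_range_iff_exists_fun.1 (hs k)
  choose a ha using hcoeff
  let e : Fin (c + n - c) ≃ Fin n := finCongr (Nat.add_sub_cancel_left c n)
  refine ⟨∏ k, s k, ?_, prod_mem (S := p.primeCompl) fun k _ => hsp k⟩
  refine Submodule.mem_iSup_of_mem (c + n) (Submodule.mem_iSup_of_mem (Fin.append f g)
    (Submodule.mem_iSup_of_mem ?_ (Ideal.subset_span
      ⟨fun k => Fin.append (-a (e k)) (Pi.single (e k) (s (e k))),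
        fun k => Fin.natAdd c (e k), fun k => ?_, ?_⟩)))
  · rw [eq_top_iff, ← hg]
    refine Submodule.span_mono ?_
    rintro _ ⟨k, rfl⟩
    exact ⟨Fin.natAdd c k, by simp⟩
  · apply Subtype.ext
    rw [Fin.sum_univ_add]
    simp [Pi.single_apply, ← ha]
  · rw [← Matrix.det_diagonal, ← Matrix.det_submatrix_equiv_self e]
    congr 1
    ext k l
    simp only [Matrix.submatrix_apply, Matrix.diagonal_apply, Matrix.of_apply, Fin.append_right,
      Pi.single_apply, EmbeddingLike.apply_eq_iff_eq]
    split_ifs with h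
    · rw [h]
    · rfl

theorem stmt10 {S : Type u} [CommRing S] [IsNoetherianRing S] (hCM : IsCohenMacaulayRing S)
    (I : Ideal S) (c : ℕ) (hunm : IsUnmixedOfHeight I c) (hgci : IsGenericallyCI I) :
    symbolicPower I 2 = Submodule.colon (I ^ 2) (fittingIdeal S ↥I c) := by
 
  apply le_antisymm
  · intro x hx
    rw [Submodule.mem_colon]
    suffices fittingIdeal S I c ≤ Submodule.colon (I ^ 2) {x} by
      intro s hs
      have := Submodule.mem_colon_singleton.1 (this hs)
      rwa [smul_eq_mul, mul_comm] at this
    refine iSup_le fun n => iSup_le fun g => iSup_le fun hg => Ideal.span_le.2 ?_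
    rintro _ ⟨r, ι, hr, rfl⟩
    refine Submodule.mem_colon_singleton.2 ?_
    rw [smul_eq_mul, mul_comm]
    refine mul_det_mem_sq_of_mem_symbolicPower hunm hgci hx (by omega) (fun i => (g i : S)) ?_ r
      (fun k => ?_) ι
    · have := congrArg (Submodule.map I.subtype) hg
      rwa [Submodule.map_span, ← Set.range_comp, Submodule.map_subtype_top] at this
    · simpa using congrArg Subtype.val (hr k)
  · intro x hx
    rw [mem_symbolicPower_iff]
    intro p hp
    have := hp.isPrime
    obtain ⟨y, hy, -⟩ := exists_generators_localization hunm hgci p hp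
    obtain ⟨s, hs, hsp⟩ := exists_mem_fittingIdeal_notMem p y hy
    refine ⟨s, hsp, ?_⟩
    have := Submodule.mem_colon.1 hx s hs
    rwa [smul_eq_mul, mul_comm] at this
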